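/- For all integers m, n with 1 < m < n: (a) BS(m,n) is not quasi-isometric to F_k × ℤ for any integer k ≥ 1, where F_k is the free group of rank k; and (b) BS(m,n) is not quasi-isometric to BS(1,q) for any integer q > 1. -/

import Mathlib

/-- A map `f` between two sets equipped with distance-like functions is a
quasi-isometry: it quasi-preserves distances and has coarsely dense image. -/
def IsQuasiIsometry {X Y : Type*} (d₁ : X → X → ℝ) (d₂ : Y → Y → ℝ) (f : X → Y) : Prop :=
  ∃ K C : ℝ, 1 ≤ K ∧ 0 ≤ C ∧
    (∀ x x' : X, d₁ x x' / K - C ≤ d₂ (f x) (f x') ∧ d₂ (f x) (f x') ≤ K * d₁ x x' + C) ∧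
    (∀ y : Y, ∃ x : X, d₂ y (f x) ≤ C)

/-- The word metric on a group `G` with respect to a generating set `S`:
`wordDist S g h` is the least length of a word in `S ∪ S⁻¹` representing `g⁻¹ * h`. -/
noncomputable def wordDist {G : Type*} [Group G] (S : Set G) (g h : G) : ℝ :=
  ((sInf {n : ℕ | ∃ l : List G, l.length = n ∧ (∀ x ∈ l, x ∈ S ∨ x⁻¹ ∈ S) ∧
      l.prod = g⁻¹ * h} : ℕ) : ℝ)

/-- Two groups are quasi-isometric if, for some finite generating sets, there is a
quasi-isometry between them with respect to the corresponding word metrics. -/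
def QuasiIsometricGroups (G H : Type*) [Group G] [Group H] : Prop :=
  ∃ (S : Finset G) (T : Finset H),
    Subgroup.closure (S : Set G) = ⊤ ∧ Subgroup.closure (T : Set H) = ⊤ ∧
    ∃ f : G → H, IsQuasiIsometry (wordDist (S : Set G)) (wordDist (T : Set H)) f

/-- The single relator `x y^m x⁻¹ y⁻ⁿ` of the Baumslag–Solitar group. -/
def BSRels (m n : ℤ) : Set (FreeGroup (Fin 2)) :=
  {FreeGroup.of 0 * FreeGroup.of 1 ^ m * (FreeGroup.of 0)⁻¹ * (FreeGroup.of 1 ^ n)⁻¹}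

/-- The Baumslag–Solitar group `BS(m,n) = ⟨x, y | x y^m x⁻¹ = y^n⟩`. -/
abbrev BS (m n : ℤ) : Type := PresentedGroup (BSRels m n)

/-- The coarse content of a quasi-isometry. -/
structure CoarseMap {G H : Type*} [Group G] [Group H] (f : G → H) : Prop where
  lipschitz : ∀ E : Set G, E.Finite → ∃ D : Set H, D.Finite ∧ ∀ g, ∀ e ∈ E, (f g)⁻¹ * f (g * e) ∈ D
  fiber : ∃ B : Set G, B.Finite ∧ ∀ g g', f g = f g' → g⁻¹ * g' ∈ B
  dense : ∃ B : Set H, B.Finite ∧ ∀ h, ∃ g, h⁻¹ * f g ∈ B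

lemma finite_setOf_prod_of_length {G : Type*} [Group G] (S : Finset G) (n : ℕ) :
    {g : G | ∃ l : List G, l.length = n ∧ (∀ x ∈ l, x ∈ (S : Set G) ∨ x⁻¹ ∈ (S : Set G)) ∧
      l.prod = g}.Finite := by
  induction n with
  | zero =>
    refine (Set.finite_singleton (1 : G)).subset ?_
    rintro g ⟨l, hl, -, rfl⟩
    simp [List.length_eq_zero_iff.1 hl]
  | succ n ih =>
    have hS : {x : G | x ∈ (S : Set G) ∨ x⁻¹ ∈ (S : Set G)}.Finite :=
      S.finite_toSet.union (S.finite_toSet.preimage inv_injective.injOn)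
    refine (Set.Finite.image2 (· * ·) hS ih).subset ?_
    rintro g ⟨l, hl, hS, rfl⟩
    cases l with
    | nil => simp at hl
    | cons a l =>
      exact ⟨a, hS a (by simp), l.prod, ⟨l, by simpa using hl,
        fun x hx => hS x (by simp [hx]), rfl⟩, by simp⟩

lemma finite_setOf_wordDist_le {G : Type*} [Group G] (S : Finset G)
    (hS : Subgroup.closure (S : Set G) = ⊤) (r : ℝ) :
    {g : G | ∀ a b : G, a⁻¹ * b = g → wordDist (S : Set G) a b ≤ r}.Finite := by
  refine ((Set.finite_Iic ⌊r⌋₊).biUnion fun n _ => finite_setOf_prod_of_length S n).subset ?_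
  intro g hg
  have h1 := hg 1 g (by simp)
  obtain ⟨l, hl, hp⟩ := Submonoid.exists_list_of_mem_closure (s := (S ∪ (S : Set G)⁻¹)) (x := g)
    (by rw [← Subgroup.closure_toSubmonoid, hS]; simp)
  have hne : {n : ℕ | ∃ l : List G, l.length = n ∧
      (∀ x ∈ l, x ∈ (S : Set G) ∨ x⁻¹ ∈ (S : Set G)) ∧ l.prod = (1 : G)⁻¹ * g}.Nonempty :=
    ⟨l.length, l, rfl, hl, by simpa using hp⟩
  have hmem := Nat.sInf_mem hne
  simp only [Set.mem_iUnion]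
  refine ⟨_, Nat.le_floor h1, ?_⟩
  simpa using hmem

lemma wordDist_congr {G : Type*} [Group G] (S : Set G) {a b a' b' : G}
    (h : a⁻¹ * b = a'⁻¹ * b') : wordDist S a b = wordDist S a' b' := by
  simp only [wordDist, h]

lemma QuasiIsometricGroups.exists_coarseMap {G H : Type*} [Group G] [Group H]
    (h : QuasiIsometricGroups G H) : ∃ f : G → H, CoarseMap f := by
  obtain ⟨S, T, hS, hT, f, K, C, hK, hC, hf, hd⟩ := h
  refine ⟨f, ?_, ?_, ?_⟩
  · intro E hE
    obtain ⟨M, hM⟩ := (hE.image fun e => wordDist (S : Set G) 1 e).bddAbove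
    refine ⟨_, finite_setOf_wordDist_le T hT (K * M + C), ?_⟩
    intro g e he a b hab
    rw [wordDist_congr _ hab]
    refine (hf _ _).2.trans ?_
    rw [wordDist_congr _ (show g⁻¹ * (g * e) = 1⁻¹ * e by group)]
    have := hM ⟨e, he, rfl⟩
    have : K * wordDist (S : Set G) 1 e ≤ K * M := by gcongr
    linarith
  · refine ⟨_, finite_setOf_wordDist_le S hS (K * C), ?_⟩
    intro g g' hg a b hab
    rw [wordDist_congr _ hab]
    have h0 : wordDist (T : Set H) (f g) (f g') = 0 := by
      simp [wordDist, hg]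
    have := (hf g g').1
    rw [h0] at this
    have h2 : wordDist (S : Set G) g g' / K ≤ C := by linarith
    rw [div_le_iff₀ (by linarith)] at h2
    linarith
  · refine ⟨_, finite_setOf_wordDist_le T hT C, ?_⟩
    intro h
    obtain ⟨g, hg⟩ := hd h
    refine ⟨g, ?_⟩
    intro a b hab
    rwa [wordDist_congr _ hab]

section PingPong

open HNNExtension HNNExtension.NormalWord

variable {G : Type*} [Group G] {A B : Subgroup G} (φ : A ≃* B) {d : TransversalPair G A B}

/-- If `t ^ u` does not cancel in `t ^ u • w`, then it cancels in `t ^ (-u) • t ^ u • w`. -/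
lemma HNNExtension.NormalWord.cancels_neg_zpow_smul (u : ℤˣ) (w : NormalWord d)
    (hw : ¬ Cancels u w) :
    Cancels (-u) ((t ^ (u : ℤ) : HNNExtension G A B φ) • w) := by
  rw [t_pow_smul_eq_unitsSMul, unitsSMul, dif_neg hw]
  simp [Cancels, cons]

end PingPong

section Expansion

open scoped Pointwise Classical

/-- Two self-maps at bounded distance from the identity that are injective with disjoint images
force every finite subset to expand by a factor two. -/
lemma two_mul_card_le_card_mul {G : Type*} [Group G] (E : Finset G) (F₁ F₂ : G → G)
    (h₁ : F₁.Injective) (h₂ : F₂.Injective) (h₁₂ : ∀ g g', F₁ g ≠ F₂ g')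
    (hE₁ : ∀ g, g⁻¹ * F₁ g ∈ E) (hE₂ : ∀ g, g⁻¹ * F₂ g ∈ E) (A : Finset G) :
    2 * A.card ≤ (A * E).card := by
  have hd : Disjoint (A.image F₁) (A.image F₂) := by
    rw [Finset.disjoint_left]
    intro x hx hx'
    simp only [Finset.mem_image] at hx hx'
    obtain ⟨g, -, rfl⟩ := hx
    obtain ⟨g', -, h⟩ := hx'
    exact h₁₂ _ _ h.symm
  have hsub : A.image F₁ ∪ A.image F₂ ⊆ A * E := by
    intro x hx
    simp only [Finset.mem_union, Finset.mem_image] at hx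
    rw [Finset.mem_mul]
    rcases hx with ⟨g, hg, rfl⟩ | ⟨g, hg, rfl⟩
    · exact ⟨g, hg, _, hE₁ g, by group⟩
    · exact ⟨g, hg, _, hE₂ g, by group⟩
  have := Finset.card_le_card hsub
  rw [Finset.card_union_of_disjoint hd, Finset.card_image_of_injective _ h₁,
    Finset.card_image_of_injective _ h₂] at this
  omega

/-- A group acting with two elements `s` and `y * s * y⁻¹` in ping-pong position has a finite
subset `E` such that every finite subset `A` satisfies `2 * |A| ≤ |A * E|`. -/
lemma exists_two_mul_card_le_of_pingPong {G X : Type*} [Group G] [MulAction G X] (x₀ : X) (s y : G)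
    (P N : Set X) (hPN : Disjoint P N) (hy : Disjoint (P ∪ N) (y • (P ∪ N)))
    (hs : ∀ x ∉ P, s • x ∈ N) :
    ∃ E : Finset G, ∀ A : Finset G, 2 * A.card ≤ (A * E).card := by
  let r : X → G := fun x => if x ∈ P then 1 else s
  have hr : ∀ x, r x • x ∈ P ∪ N := by
    intro x
    by_cases hx : x ∈ P
    · simp [r, hx]
    · simp [r, hx, hs x hx]
  have hr' : ∀ x x', r x • x = r x' • x' → r x = r x' := by
    intro x x' h
    by_cases hx : x ∈ P <;> by_cases hx' : x' ∈ P <;> simp only [r, hx, hx', if_true, if_false]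
    · simp only [r, hx, hx', if_true, if_false, one_smul] at h
      exact absurd (h ▸ hs x' hx') (Set.disjoint_left.1 hPN hx)
    · simp only [r, hx, hx', if_true, if_false, one_smul] at h
      exact absurd (h ▸ hs x hx) (Set.disjoint_left.1 hPN hx')
  have key : ∀ g g' : G, r (g⁻¹ • x₀) * g⁻¹ = r (g'⁻¹ • x₀) * g'⁻¹ → g = g' := by
    intro g g' h
    have h1 := hr' (g⁻¹ • x₀) (g'⁻¹ • x₀) (by rw [← mul_smul, ← mul_smul, h])
    rw [h1] at h
    exact inv_injective (mul_left_cancel h)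
  refine ⟨{1, s⁻¹, y * s⁻¹ * y⁻¹}, two_mul_card_le_card_mul _
    (fun g => (r (g⁻¹ • x₀) * g⁻¹)⁻¹)
    (fun g => (y * (r ((g * y)⁻¹ • x₀) * (g * y)⁻¹))⁻¹) ?_ ?_ ?_ ?_ ?_⟩
  · intro g g' h
    exact key g g' (inv_injective h)
  · intro g g' h
    exact mul_right_cancel (key _ _ (mul_left_cancel (inv_injective h)))
  · intro g g' h
    have h1 := congrArg (fun z => z • x₀) (inv_injective h)
    simp only [mul_smul] at h1
    refine Set.disjoint_left.1 hy (hr (g⁻¹ • x₀)) ?_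
    rw [h1]
    exact Set.smul_mem_smul_set (by simpa only [mul_smul] using hr ((g' * y)⁻¹ • x₀))
  · intro g
    by_cases hx : g⁻¹ • x₀ ∈ P <;> simp [r, hx]
  · intro g
    by_cases hx : (g * y)⁻¹ • x₀ ∈ P
    · simp only [r, hx, if_true]
      simp
    · simp only [r, hx, if_false]
      simp [mul_assoc]

lemma exists_mul_card_le_card_mul {G : Type*} [Group G] (E : Finset G)
    (hE : ∀ A : Finset G, 2 * A.card ≤ (A * E).card) (M : ℕ) :
    ∃ E' : Finset G, ∀ A : Finset G, M * A.card ≤ (A * E').card := by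
  have key : ∀ k : ℕ, ∀ A : Finset G, 2 ^ k * A.card ≤ (A * E ^ k).card := by
    intro k
    induction k with
    | zero => simp
    | succ k ih =>
      intro A
      calc 2 ^ (k + 1) * A.card = 2 * (2 ^ k * A.card) := by ring
        _ ≤ 2 * (A * E ^ k).card := by gcongr; exact ih A
        _ ≤ (A * E ^ k * E).card := hE _
        _ = (A * E ^ (k + 1)).card := by rw [pow_succ, mul_assoc]
  exact ⟨E ^ M, fun A => (Nat.mul_le_mul_right _ Nat.lt_two_pow_self.le).trans (key M A)⟩

lemma CoarseMap.exists_card_le {G H : Type*} [Group G] [Group H] {f : G → H} (hf : CoarseMap f) :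
    ∃ B : ℕ, ∀ S : Finset G, S.card ≤ B * (S.image f).card := by
  obtain ⟨B, hB, hfib⟩ := hf.fiber
  lift B to Finset G using hB
  refine ⟨B.card, fun S => Finset.card_le_mul_card_image S _ ?_⟩
  intro h hh
  obtain ⟨g₀, hg₀, rfl⟩ := Finset.mem_image.1 hh
  refine Finset.card_le_card_of_injOn (fun g => g₀⁻¹ * g) ?_ ?_
  · intro g hg
    simp only [Finset.mem_coe, Finset.mem_filter] at hg
    exact hfib _ _ hg.2.symm
  · intro g _ g' _ h
    exact mul_left_cancel h

/-- Expansion of finite subsets is incompatible with a coarse map onto a group with Følner sets. -/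
lemma CoarseMap.not_folner {G H : Type*} [Group G] [Group H] {f : G → H} (hf : CoarseMap f)
    (hG : ∀ M : ℕ, ∃ E : Finset G, ∀ A : Finset G, M * A.card ≤ (A * E).card)
    (hH : ∀ E : Finset H, ∃ F : Finset H, F.Nonempty ∧ (F * E).card ≤ 2 * F.card) : False := by
  obtain ⟨B, fib_le⟩ := hf.exists_card_le
  obtain ⟨B', hB', hdense⟩ := hf.dense
  lift B' to Finset H using hB'
  obtain ⟨E, hE⟩ := hG (2 * B * B'.card + 1)
  obtain ⟨D, hD, hlip⟩ := hf.lipschitz E E.finite_toSet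
  lift D to Finset H using hD
  obtain ⟨F, hF, hFc⟩ := hH (B' * D)
  choose c hc using hdense
  let A := F.image c
  have hA : A.Nonempty := hF.image c
  have hFA : F.card ≤ A.card * B'.card := by
    have : F ⊆ Finset.image₂ (fun g b => f g * b⁻¹) A B' := by
      intro h hh
      rw [Finset.mem_image₂]
      exact ⟨c h, Finset.mem_image_of_mem _ hh, _, hc h, by group⟩
    exact (Finset.card_le_card this).trans (Finset.card_image₂_le _ _ _)
  have hAE : (A * E).image f ⊆ F * (B' * D) := by
    intro z hz
    simp only [Finset.mem_image, Finset.mem_mul, A] at hz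
    obtain ⟨_, ⟨_, ⟨h, hh, rfl⟩, e, he, rfl⟩, rfl⟩ := hz
    rw [← mul_assoc, Finset.mem_mul]
    refine ⟨f (c h), ?_, _, hlip (c h) e he, by group⟩
    rw [Finset.mem_mul]
    exact ⟨h, hh, _, hc h, by group⟩
  have h1 := hE A
  have h2 := fib_le (A * E)
  have h3 := Finset.card_le_card hAE
  have h4 : (A * E).card ≤ 2 * B * B'.card * A.card := by
    calc (A * E).card ≤ B * ((A * E).image f).card := h2
      _ ≤ B * (2 * (A.card * B'.card)) := by gcongr; omega
      _ = _ := by ring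
  have := hA.card_pos
  nlinarith

/-- Sets that are asymptotically invariant under generators are asymptotically invariant under
all elements. -/
lemma exists_card_mul_le_of_closure_eq_top {G : Type*} [Group G] (S : Set G)
    (hS : Subgroup.closure S = ⊤) (F : ℕ → Finset G) (hF : ∀ N, (F (N + 1)).Nonempty)
    (hSF : ∀ s ∈ S, ∀ K : ℕ, ∀ N ≥ K, K * ((F N).image (· * s) \ F N).card ≤ (F N).card)
    (E : Finset G) : ∃ N, (F N).Nonempty ∧ (F N * E).card ≤ 2 * (F N).card := by
  have key : ∀ e : G, ∀ K : ℕ, ∀ᶠ N in Filter.atTop,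
      K * ((F N).image (· * e) \ F N).card ≤ (F N).card := by
    intro e
    have he : e ∈ Subgroup.closure S := by simp [hS]
    induction he using Subgroup.closure_induction with
    | mem s hs =>
      intro K
      filter_upwards [Filter.eventually_ge_atTop K] with N hN using hSF s hs K N hN
    | one => simp
    | mul a b _ _ ha hb =>
      intro K
      filter_upwards [ha (2 * K), hb (2 * K)] with N h1 h2
      have hsub : (F N).image (· * (a * b)) \ F N ⊆
          ((F N).image (· * a) \ F N).image (· * b) ∪ ((F N).image (· * b) \ F N) := by
        intro z hz
        simp only [Finset.mem_sdiff, Finset.mem_image, Finset.mem_union] at hz ⊢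
        obtain ⟨⟨g, hg, rfl⟩, hz⟩ := hz
        by_cases hga : g * a ∈ F N
        · exact Or.inr ⟨⟨_, hga, mul_assoc _ _ _⟩, hz⟩
        · exact Or.inl ⟨g * a, ⟨⟨g, hg, rfl⟩, hga⟩, mul_assoc _ _ _⟩
      have h3 := (Finset.card_le_card hsub).trans (Finset.card_union_le _ _)
      have h4 := Finset.card_image_le (s := (F N).image (· * a) \ F N) (f := (· * b))
      have h5 := Nat.mul_le_mul_left K (h3.trans (Nat.add_le_add_right h4 _))
      nlinarith
    | inv a _ ha =>
      intro K
      filter_upwards [ha K] with N h1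
      have h2 : ((F N).image (· * a⁻¹) \ F N).card = ((F N).image (· * a) \ F N).card := by
        have h3 : ((F N).image (· * a⁻¹) \ F N).image (· * a) = F N \ (F N).image (· * a) := by
          rw [Finset.image_sdiff _ _ (mul_left_injective a), Finset.image_image]
          simp [Function.comp_def]
        rw [← Finset.card_image_of_injective _ (mul_left_injective a), h3]
        exact Finset.card_sdiff_comm (Finset.card_image_of_injective _ (mul_left_injective a)).symm
      rwa [h2]
  have hall : ∀ᶠ N in Filter.atTop, ∀ e ∈ E,
      E.card * ((F N).image (· * e) \ F N).card ≤ (F N).card :=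
    (Filter.eventually_all_finset E).2 fun e _ => key e _
  obtain ⟨N, hN, hN1⟩ := (hall.and (Filter.eventually_ge_atTop 1)).exists
  obtain ⟨N, rfl⟩ := Nat.exists_eq_add_of_le' hN1
  refine ⟨N + 1, hF N, ?_⟩
  have hsub : F (N + 1) * E ⊆
      F (N + 1) ∪ E.biUnion fun e => (F (N + 1)).image (· * e) \ F (N + 1) := by
    intro z hz
    obtain ⟨g, hg, e, he, rfl⟩ := Finset.mem_mul.1 hz
    by_cases h : g * e ∈ F (N + 1)
    · exact Finset.mem_union_left _ h
    · refine Finset.mem_union_right _ (Finset.mem_biUnion.2 ⟨e, he, ?_⟩)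
      exact Finset.mem_sdiff.2 ⟨Finset.mem_image_of_mem _ hg, h⟩
  have h1 := (Finset.card_le_card hsub).trans (Finset.card_union_le _ _)
  have h2 := Finset.card_biUnion_le (s := E)
    (t := fun e => (F (N + 1)).image (· * e) \ F (N + 1))
  rcases E.eq_empty_or_nonempty with rfl | hE
  · simp
  have h3 : E.card * ∑ e ∈ E, ((F (N + 1)).image (· * e) \ F (N + 1)).card ≤
      E.card * (F (N + 1)).card := by
    rw [Finset.mul_sum, ← smul_eq_mul E.card (F (N + 1)).card, ← Finset.sum_const]
    exact Finset.sum_le_sum hN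
  have h4 := Nat.le_of_mul_le_mul_left h3 hE.card_pos
  omega

end Expansion

section BaumslagSolitar

/-- A pair `x, y` in a group with `x * y ^ m * x⁻¹ = y ^ n` induces a homomorphism from
`BS m n`. -/
def BS.lift {G : Type*} [Group G] {m n : ℤ} (x y : G) (h : x * y ^ m * x⁻¹ = y ^ n) :
    BS m n →* G :=
  PresentedGroup.toGroup (f := ![x, y]) (by
    rintro r rfl
    simp [h])

/-- The stable letter of `BS m n`. -/
def BS.x {m n : ℤ} : BS m n := PresentedGroup.of 0

/-- The base generator of `BS m n`. -/
def BS.y {m n : ℤ} : BS m n := PresentedGroup.of 1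

@[simp] lemma BS.lift_x {G : Type*} [Group G] {m n : ℤ} (x y : G)
    (h : x * y ^ m * x⁻¹ = y ^ n) : BS.lift x y h BS.x = x := by
  simp [BS.lift, BS.x]

@[simp] lemma BS.lift_y {G : Type*} [Group G] {m n : ℤ} (x y : G)
    (h : x * y ^ m * x⁻¹ = y ^ n) : BS.lift x y h BS.y = y := by
  simp [BS.lift, BS.y]

lemma BS.relation (m n : ℤ) : (BS.x : BS m n) * BS.y ^ m * BS.x⁻¹ = BS.y ^ n := by
  have h := PresentedGroup.one_of_mem (rels := BSRels m n) (x := FreeGroup.of 0 *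
    FreeGroup.of 1 ^ m * (FreeGroup.of 0)⁻¹ * (FreeGroup.of 1 ^ n)⁻¹) rfl
  simp only [map_mul, map_inv, map_zpow] at h
  exact mul_inv_eq_one.1 h

lemma BS.closure_eq_top (m n : ℤ) : Subgroup.closure {(BS.x : BS m n), BS.y} = ⊤ := by
  rw [← PresentedGroup.closure_range_of (BSRels m n)]
  congr 1
  ext g
  simp only [Set.mem_insert_iff, Set.mem_singleton_iff, Set.mem_range, Fin.exists_fin_two]
  exact or_congr eq_comm eq_comm

open HNNExtension HNNExtension.NormalWord in
open scoped Pointwise Classical in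
lemma BS.exists_two_mul_card_le {m n : ℤ} (hm : 1 < m) (hn : 1 < n) :
    ∃ E : Finset (BS m n), ∀ A : Finset (BS m n), 2 * A.card ≤ (A * E).card := by
  have inj : ∀ k : ℤ, 1 < k →
      Function.Injective (zpowGroupHom k : Multiplicative ℤ →* Multiplicative ℤ) :=
    fun k hk a b h => zpow_left_injective (by omega) h
  let A := (zpowGroupHom m : Multiplicative ℤ →* Multiplicative ℤ).range
  let B := (zpowGroupHom n : Multiplicative ℤ →* Multiplicative ℤ).range
  let φ : A ≃* B := (MonoidHom.ofInjective (inj m hm)).symm.trans (MonoidHom.ofInjective (inj n hn))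
  have hφ : ∀ a : Multiplicative ℤ, (φ ⟨a ^ m, a, rfl⟩ : Multiplicative ℤ) = a ^ n := by
    intro a
    have : (⟨a ^ m, a, rfl⟩ : A) = MonoidHom.ofInjective (inj m hm) a := rfl
    rw [this]
    simp only [φ, MulEquiv.trans_apply, MulEquiv.symm_apply_apply]
    rfl
  obtain ⟨d⟩ := TransversalPair.nonempty (Multiplicative ℤ) A B
  let b : Multiplicative ℤ := Multiplicative.ofAdd 1
  have hb : ∀ u, b ∉ toSubgroup A B u := by
    have hb' : ∀ k : ℤ, 1 < k → ∀ a : Multiplicative ℤ, a ^ k ≠ b := by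
      intro k hk a ha
      have h1 : k * a.toAdd = 1 := by simpa [b] using congrArg Multiplicative.toAdd ha
      have := Int.eq_one_or_neg_one_of_mul_eq_one h1
      omega
    intro u hu
    rcases Int.units_eq_one_or u with rfl | rfl
    · obtain ⟨a, ha⟩ := hu
      exact hb' m hm a ha
    · obtain ⟨a, ha⟩ := hu
      exact hb' n hn a ha
  let ρ : BS m n →* HNNExtension (Multiplicative ℤ) A B φ := BS.lift t (of b) (by
    have := equiv_eq_conj (φ := φ) ⟨b ^ m, b, rfl⟩
    rw [hφ] at this
    simpa using this.symm)
  let _ : MulAction (BS m n) (NormalWord d) := MulAction.compHom _ ρ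
  have hx : ∀ w : NormalWord d, (BS.x : BS m n)⁻¹ • w =
      (t ^ ((-1 : ℤˣ) : ℤ) : HNNExtension _ A B φ) • w := by
    intro w
    change ρ (BS.x : BS m n)⁻¹ • w = _
    simp [ρ]
  have hy : ∀ w : NormalWord d, (BS.y : BS m n) • w = b • w := by
    intro w
    change ρ (BS.y : BS m n) • w = _
    simp [ρ, of_smul_eq_smul]
  refine exists_two_mul_card_le_of_pingPong (X := NormalWord d) .empty
    (BS.x : BS m n)⁻¹ BS.y {w | Cancels (-1) w} {w | Cancels 1 w} ?_ ?_ ?_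
  · rw [Set.disjoint_left]
    rintro w ⟨-, h⟩ ⟨-, h'⟩
    rw [h] at h'
    simp at h'
  · rw [Set.disjoint_left]
    rintro w h1 ⟨w', h2, h3⟩
    dsimp only at h3
    rw [hy] at h3
    subst h3
    have e : ∀ u, Cancels u w' → ∀ u', Cancels u' (b • w') → False := by
      rintro u ⟨h, hu⟩ u' ⟨h', hu'⟩
      rw [group_smul_toList, hu] at hu'
      simp only [Option.some.injEq, neg_inj] at hu'
      subst hu'
      rw [group_smul_head] at h'
      exact hb _ ((Subgroup.mul_mem_cancel_right _ h).1 h')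
    rcases h1 with h1 | h1 <;> rcases h2 with h2 | h2 <;> exact e _ h2 _ h1
  · intro w hw
    rw [hx]
    simpa using cancels_neg_zpow_smul φ (-1) w hw

/-- The affine action of `BS m n` on `ℚ`: `x` is multiplication by `n / m`, `y` is translation
by one. -/
noncomputable def BS.affine {m n : ℤ} (hm : m ≠ 0) (hn : n ≠ 0) : BS m n →* Equiv.Perm ℚ :=
  BS.lift (Equiv.mulLeft₀ ((n : ℚ) / m) (by positivity)) (Equiv.addRight 1) (by
    have hm' : (m : ℚ) ≠ 0 := by exact_mod_cast hm
    have hn' : (n : ℚ) ≠ 0 := by exact_mod_cast hn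
    rw [mul_inv_eq_iff_eq_mul]
    ext z
    simp
    field_simp)

/-- The height homomorphism, counting the stable letter. -/
def BS.height {m n : ℤ} : BS m n →* Multiplicative ℤ :=
  BS.lift (Multiplicative.ofAdd 1) 1 (by simp)

lemma BS.semiconjBy_pow (q i : ℕ) :
    SemiconjBy ((BS.x : BS 1 q) ^ i) BS.y (BS.y ^ q ^ i) := by
  have h : SemiconjBy (BS.x : BS 1 q) BS.y (BS.y ^ q) := by
    have := BS.relation 1 q
    rw [zpow_one, mul_inv_eq_iff_eq_mul, zpow_natCast] at this
    exact this
  induction i with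
  | zero => simp
  | succ i ih =>
    rw [pow_succ, pow_succ, pow_mul]
    exact (ih.pow_right q).mul_left h

lemma BS.pow_mul_pow_injective {q : ℕ} (hq : 0 < q) :
    Function.Injective fun p : ℕ × ℕ => (BS.y : BS 1 q) ^ p.2 * BS.x ^ p.1 := by
  rintro ⟨i, k⟩ ⟨i', k'⟩ h
  dsimp only at h
  have h1 := congrArg (fun g => (BS.height g).toAdd) h
  simp [BS.height] at h1
  subst h1
  have h2 := congrArg (fun g => BS.affine one_ne_zero (by exact_mod_cast hq.ne') g 0)
    (mul_right_cancel h)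
  simpa [BS.affine] using h2

open scoped Pointwise Classical in
lemma BS.exists_card_mul_le {q : ℤ} (hq : 1 < q) (E : Finset (BS 1 q)) :
    ∃ F : Finset (BS 1 q), F.Nonempty ∧ (F * E).card ≤ 2 * F.card := by
  lift q to ℕ using by omega
  have hq0 : 0 < q := by omega
  let c : ℕ × ℕ → BS 1 q := fun p => (BS.y : BS 1 q) ^ p.2 * BS.x ^ p.1
  have hc : Function.Injective c := BS.pow_mul_pow_injective hq0
  let F : ℕ → Finset (BS 1 q) := fun N =>
    (Finset.range N ×ˢ Finset.range (N * q ^ N)).image c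
  have hF : ∀ N, (F N).card = N * (N * q ^ N) := by
    intro N
    simp [F, Finset.card_image_of_injective _ hc]
  obtain ⟨N, hN⟩ := exists_card_mul_le_of_closure_eq_top _ (BS.closure_eq_top 1 q) F
    (fun N => Finset.card_pos.1 (by rw [hF]; positivity)) (by
      intro s hs K N hKN
      suffices ((F N).image (· * s) \ F N).card ≤ N * q ^ N by
        rw [hF]
        exact Nat.mul_le_mul hKN this
      rcases hs with rfl | rfl
      · refine (Finset.card_le_card (t := (Finset.range (N * q ^ N)).image
          fun k => c (N, k)) ?_).trans (Finset.card_image_le.trans (by simp))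
        intro z hz
        simp only [F, Finset.mem_sdiff, Finset.mem_image, Finset.mem_product, Finset.mem_range,
          Prod.exists, not_exists] at hz ⊢
        obtain ⟨⟨_, ⟨i, k, ⟨hi, hk⟩, rfl⟩, rfl⟩, hz⟩ := hz
        refine ⟨k, hk, ?_⟩
        have hi' : i + 1 = N := by
          by_contra hne
          exact hz (i + 1) k ⟨⟨by omega, hk⟩, by simp [c, pow_succ, mul_assoc]⟩
        simp [c, ← hi', pow_succ, mul_assoc]
      · refine (Finset.card_le_card (t := (Finset.range N ×ˢ Finset.range (q ^ N)).image
          fun p => c (p.1, N * q ^ N + p.2)) ?_).trans (Finset.card_image_le.trans (by simp))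
        intro z hz
        simp only [F, Finset.mem_sdiff, Finset.mem_image, Finset.mem_product, Finset.mem_range,
          Prod.exists, not_exists] at hz ⊢
        obtain ⟨⟨_, ⟨i, k, ⟨hi, hk⟩, rfl⟩, rfl⟩, hz⟩ := hz
        have hcy : c (i, k) * BS.y = c (i, k + q ^ i) := by
          simp only [c]
          rw [mul_assoc, (BS.semiconjBy_pow q i).eq, pow_add, mul_assoc]
        rw [hcy] at hz ⊢
        have hle : N * q ^ N ≤ k + q ^ i := by
          by_contra hlt
          exact hz i _ ⟨⟨hi, not_le.1 hlt⟩, rfl⟩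
        have hqi : q ^ i ≤ q ^ N := Nat.pow_le_pow_right hq0 hi.le
        refine ⟨i, k + q ^ i - N * q ^ N, ⟨hi, by omega⟩, ?_⟩
        rw [Nat.add_sub_cancel' hle]) E
  exact ⟨F N, hN⟩

theorem BS.not_quasiIsometric_solvable {m n q : ℤ} (hm : 1 < m) (hn : 1 < n) (hq : 1 < q) :
    ¬ QuasiIsometricGroups (BS m n) (BS 1 q) := by
  intro h
  obtain ⟨f, hf⟩ := h.exists_coarseMap
  obtain ⟨E, hE⟩ := BS.exists_two_mul_card_le hm hn
  exact hf.not_folner (exists_mul_card_le_card_mul E hE) (BS.exists_card_mul_le hq)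

end BaumslagSolitar

section FreeGroupSuffix

lemma FreeGroup.toWord_mk_singleton_mul {α : Type*} [DecidableEq α] (s : α × Bool)
    (u : FreeGroup α) :
    (FreeGroup.mk [s] * u).toWord = s :: u.toWord ∨
      ∃ x, u.toWord = x :: (FreeGroup.mk [s] * u).toWord := by
  have h : (FreeGroup.mk [s] * u).toWord = FreeGroup.reduce (s :: u.toWord) := by
    conv_lhs => rw [← FreeGroup.mk_toWord (x := u), FreeGroup.mul_mk]
    rw [FreeGroup.toWord_mk]
    rfl
  rw [h, FreeGroup.reduce.cons, FreeGroup.reduce_toWord]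
  cases u.toWord with
  | nil => simp
  | cons a l =>
    dsimp only
    split_ifs
    · exact Or.inr ⟨a, rfl⟩
    · exact Or.inl rfl

/-- In a free group, left multiplication by `δ` can only move `u` across the set of elements
with suffix `w` if `u` is close to `w`. -/
lemma FreeGroup.exists_finite_suffix_crossing {α : Type*} [DecidableEq α] (δ : FreeGroup α) :
    ∃ N : Finset (FreeGroup α), ∀ (w : List (α × Bool)) (u : FreeGroup α),
      ¬ (w <:+ (δ * u).toWord ↔ w <:+ u.toWord) → ∃ ν ∈ N, (ν * u).toWord = w := by
  have letter : ∀ s : α × Bool, ∃ N : Finset (FreeGroup α), ∀ (w : List (α × Bool))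
      (u : FreeGroup α), ¬ (w <:+ (FreeGroup.mk [s] * u).toWord ↔ w <:+ u.toWord) →
        ∃ ν ∈ N, (ν * u).toWord = w := by
    intro s
    refine ⟨{1, FreeGroup.mk [s]}, fun w u h => ?_⟩
    simp only [Finset.mem_insert, Finset.mem_singleton, exists_eq_or_imp, exists_eq_left, one_mul]
    rcases FreeGroup.toWord_mk_singleton_mul s u with h' | ⟨x, h'⟩
    · rw [h', List.suffix_cons_iff] at h
      rw [h']
      tauto
    · have h2 : w <:+ u.toWord ↔
          w = u.toWord ∨ w <:+ (FreeGroup.mk [s] * u).toWord := by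
        conv_lhs => rw [h', List.suffix_cons_iff, ← h']
      tauto
  induction δ using FreeGroup.induction_on with
  | C1 => exact ⟨∅, fun w u h => by simp at h⟩
  | of i => exact letter (i, true)
  | inv_of i _ => exact letter (i, false)
  | mul a b ha hb =>
    obtain ⟨Na, ha⟩ := ha
    obtain ⟨Nb, hb⟩ := hb
    refine ⟨Na.image (· * b) ∪ Nb, fun w u h => ?_⟩
    by_cases h1 : w <:+ (b * u).toWord ↔ w <:+ u.toWord
    · rw [mul_assoc, ← h1] at h
      obtain ⟨ν, hν, e⟩ := ha w _ h
      exact ⟨ν * b, Finset.mem_union_left _ (Finset.mem_image_of_mem _ hν), by rwa [mul_assoc]⟩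
    · obtain ⟨ν, hν, e⟩ := hb w u h1
      exact ⟨ν, Finset.mem_union_right _ hν, e⟩

/-- A balanced separator for suffixes: among `L` words over an alphabet, each attained few times,
some suffix is shared by a definite proportion of the words, but by at most half of them. -/
lemma exists_balanced_suffix {α : Type*} [Fintype α] [DecidableEq α] (u : ℕ → List α)
    (L T : ℕ) (hL : 0 < L) (hT : ∀ w, ((Finset.range L).filter fun q => u q = w).card ≤ T)
    (hTL : 4 * T ≤ L) :
    ∃ w, L ≤ 4 * (Fintype.card α + 1) * ((Finset.range L).filter fun q => w <:+ u q).card ∧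
      2 * ((Finset.range L).filter fun q => w <:+ u q).card ≤ L := by
  set p := Fintype.card α
  set count : List α → ℕ := fun w => ((Finset.range L).filter fun q => w <:+ u q).card
  by_contra! hcon
  have hchild : ∀ w, count w ≤ T + ∑ x, count (x :: w) := by
    intro w
    have hsub : (Finset.range L).filter (fun q => w <:+ u q) ⊆
        (Finset.range L).filter (fun q => u q = w) ∪
          Finset.univ.biUnion fun x => (Finset.range L).filter (fun q => (x :: w) <:+ u q) := by
      intro q hq
      simp only [Finset.mem_filter, Finset.mem_union, Finset.mem_biUnion, Finset.mem_univ,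
        true_and] at hq ⊢
      obtain ⟨hq, t, ht⟩ := hq
      rcases List.eq_nil_or_concat t with rfl | ⟨t', x, rfl⟩
      · exact Or.inl ⟨hq, by simpa using ht.symm⟩
      · exact Or.inr ⟨x, hq, t', by simpa using ht⟩
    refine (Finset.card_le_card hsub).trans ((Finset.card_union_le _ _).trans ?_)
    exact Nat.add_le_add (hT w) Finset.card_biUnion_le
  have key : ∀ l : ℕ, ∃ w : List α, w.length = l ∧ L ≤ 4 * (p + 1) * count w := by
    intro l
    induction l with
    | zero => exact ⟨[], rfl, by simp [count]; nlinarith⟩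
    | succ l ih =>
      obtain ⟨w, hw, hwL⟩ := ih
      by_contra! hlight
      have h1 : ∑ x, 4 * (p + 1) * count (x :: w) ≤ ∑ _x : α, L :=
        Finset.sum_le_sum fun x _ => (hlight (x :: w) (by simp [hw])).le
      rw [← Finset.mul_sum, Finset.sum_const, Finset.card_univ, smul_eq_mul] at h1
      have h2 : 4 * ∑ x, count (x :: w) ≤ L := by
        have : (p + 1) * (4 * ∑ x, count (x :: w)) ≤ (p + 1) * L := by
          change _ ≤ p * L at h1
          nlinarith
        exact Nat.le_of_mul_le_mul_left this (by omega)
      have h3 := hchild w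
      have h4 := hcon w hwL
      change L < 2 * count w at h4
      omega
  obtain ⟨w, hw, hwL⟩ := key ((∑ q ∈ Finset.range L, (u q).length) + 1)
  have : count w = 0 := by
    rw [Finset.card_eq_zero, Finset.filter_eq_empty_iff]
    intro q hq hs
    have h1 := hs.length_le
    have h2 := Finset.single_le_sum (f := fun q => (u q).length) (fun _ _ => Nat.zero_le _) hq
    omega
  rw [this] at hwL
  omega

end FreeGroupSuffix

lemma exists_pow_mul_lt_pow {m n : ℕ} (hmn : m < n) (c : ℕ) :
    ∃ h : ℕ, m ^ h * (c * (h + 1) ^ 2) < n ^ h := by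
  have hn : (0 : ℝ) < n := by exact_mod_cast (Nat.zero_le m).trans_lt hmn
  have hr : |(m : ℝ) / n| < 1 := by
    rw [abs_of_nonneg (by positivity), div_lt_one hn]
    exact_mod_cast hmn
  have h1 := (tendsto_pow_const_mul_const_pow_of_abs_lt_one 2 hr).const_mul (4 * c : ℝ)
  rw [mul_zero] at h1
  obtain ⟨h, hh, hh1⟩ := ((h1.eventually_lt_const one_pos).and
    (Filter.eventually_ge_atTop 1)).exists
  refine ⟨h, ?_⟩
  have h2 : (m : ℝ) ^ h * (c * (h + 1) ^ 2) < n ^ h := by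
    have hh1' : (1 : ℝ) ≤ h := by exact_mod_cast hh1
    have h3 : ((h : ℝ) + 1) ^ 2 ≤ 4 * h ^ 2 := by nlinarith
    calc (m : ℝ) ^ h * (c * (h + 1) ^ 2) ≤ (m : ℝ) ^ h * (c * (4 * h ^ 2)) := by gcongr
      _ = 4 * (c : ℝ) * (h ^ 2 * ((m : ℝ) / n) ^ h) * (n : ℝ) ^ h := by
        rw [div_pow]
        field_simp
      _ < 1 * (n : ℝ) ^ h := by gcongr
      _ = (n : ℝ) ^ h := one_mul _
  exact_mod_cast h2

section Tower

/-- The number `m ^ k * (∑ j < k, a j * (n / m) ^ j + (n / m) ^ k * p)`. -/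
def rationalNumeral (m n : ℕ) : ℕ → (ℕ → ℕ) → ℕ → ℕ
  | 0, _, p => p
  | k + 1, a, p => a 0 * m ^ (k + 1) + n * rationalNumeral m n k (fun j => a (j + 1)) p

lemma rationalNumeral_injective {m n : ℕ} (hmn : m.Coprime n) (hn : 0 < n) (k : ℕ) (a b : ℕ → ℕ)
    (p p' : ℕ) (ha : ∀ j, a j < n) (hb : ∀ j, b j < n)
    (h : rationalNumeral m n k a p = rationalNumeral m n k b p') :
    (∀ j < k, a j = b j) ∧ p = p' := by
  induction k generalizing a b with
  | zero => exact ⟨by simp, h⟩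
  | succ k ih =>
    simp only [rationalNumeral] at h
    have h0 : a 0 = b 0 := by
      have h1 : a 0 * m ^ (k + 1) ≡ b 0 * m ^ (k + 1) [MOD n] := by
        have := congrArg (· % n) h
        simpa [Nat.ModEq, Nat.add_mul_mod_self_left] using this
      have h2 := Nat.ModEq.cancel_right_of_coprime (hmn.symm.pow_right (k + 1)) h1
      exact Nat.ModEq.eq_of_lt_of_lt h2 (ha 0) (hb 0)
    rw [h0] at h
    obtain ⟨h1, h2⟩ := ih _ _ (fun j => ha (j + 1)) (fun j => hb (j + 1))
      (Nat.eq_of_mul_eq_mul_left hn (Nat.add_left_cancel h))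
    refine ⟨fun j hj => ?_, h2⟩
    cases j with
    | zero => exact h0
    | succ j => exact h1 j (by omega)

namespace BS

/-- The product `y ^ a 0 * x * y ^ a 1 * x * ⋯ * y ^ a (k - 1) * x`. -/
def tower {m n : ℤ} (a : ℕ → ℕ) (k : ℕ) : BS m n :=
  ((List.range k).map fun j => BS.y ^ a j * BS.x).prod

lemma tower_succ {m n : ℤ} (a : ℕ → ℕ) (k : ℕ) :
    (tower a (k + 1) : BS m n) = tower a k * (BS.y ^ a k * BS.x) := by
  simp [tower, List.range_succ]

lemma tower_succ' {m n : ℤ} (a : ℕ → ℕ) (k : ℕ) :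
    (tower a (k + 1) : BS m n) = BS.y ^ a 0 * BS.x * tower (fun j => a (j + 1)) k := by
  simp [tower, List.range_succ_eq_map, Function.comp_def]

lemma affine_tower {d m n : ℕ} (hd : 0 < d) (hm : ((d * m : ℕ) : ℤ) ≠ 0) (hn : ((d * n : ℕ) : ℤ) ≠ 0)
    (a : ℕ → ℕ) (k p : ℕ) :
    (m : ℚ) ^ k * affine hm hn (tower a k * BS.y ^ p) 0 = rationalNumeral m n k a p := by
  induction k generalizing a with
  | zero => simp [tower, affine, rationalNumeral]
  | succ k ih =>
    have hm' : (m : ℚ) ≠ 0 := by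
      intro h
      apply hm
      simp [Nat.cast_eq_zero.1 h]
    have hd' : (d : ℚ) ≠ 0 := by exact_mod_cast hd.ne'
    rw [tower_succ', mul_assoc, map_mul, Equiv.Perm.mul_apply]
    have h1 : ∀ z : ℚ, affine hm hn (BS.y ^ a 0 * BS.x) z = n / m * z + a 0 := by
      intro z
      simp [affine]
      field_simp
      simp
    rw [h1, rationalNumeral]
    push_cast
    rw [← ih]
    field_simp
    ring

lemma tower_mul_pow_injective {d m n : ℕ} (hd : 0 < d) (hm : 0 < m) (hn : 0 < n)
    (hmn : m.Coprime n) (a b : ℕ → ℕ) (ha : ∀ j, a j < n) (hb : ∀ j, b j < n) (k p p' : ℕ)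
    (h : (tower a k * BS.y ^ p : BS (d * m : ℕ) (d * n : ℕ)) = tower b k * BS.y ^ p') :
    (∀ j < k, a j = b j) ∧ p = p' := by
  have hm' : ((d * m : ℕ) : ℤ) ≠ 0 := by positivity
  have hn' : ((d * n : ℕ) : ℤ) ≠ 0 := by positivity
  refine rationalNumeral_injective hmn hn k a b p p' ha hb ?_
  have h1 := affine_tower hd hm' hn' a k p
  rw [h, affine_tower hd hm' hn' b k p'] at h1
  exact_mod_cast h1.symm

/-- The `k`-th vertex on the path that starts at `y ^ (n * q)` and climbs along `tower a`. -/
def climb {m n : ℕ} (q : ℕ) (a : ℕ → ℕ) (k : ℕ) : BS m n :=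
  tower a k * BS.y ^ (n * (fun u => m * u / n)^[k] q)

lemma climb_succ {m n : ℕ} (q : ℕ) (a : ℕ → ℕ) (k : ℕ) :
    (climb q a (k + 1) : BS m n) = climb q a k *
      (BS.y ^ a k * BS.x * (BS.y ^ (m * (fun u => m * u / n)^[k] q % n))⁻¹) := by
  simp only [climb, Function.iterate_succ_apply']
  generalize (fun u => m * u / n)^[k] q = u
  have hrel : ∀ u : ℕ, (BS.y : BS m n) ^ (n * u) * BS.x = BS.x * BS.y ^ (m * u) := by
    intro u
    have h : SemiconjBy (BS.x : BS m n) (BS.y ^ m) (BS.y ^ n) := by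
      have := BS.relation (m : ℤ) n
      rw [mul_inv_eq_iff_eq_mul, zpow_natCast, zpow_natCast] at this
      exact this
    rw [pow_mul, pow_mul]
    exact (h.pow_right u).eq.symm
  have hsplit : (BS.y : BS m n) ^ (m * u) = BS.y ^ (n * (m * u / n)) * BS.y ^ (m * u % n) := by
    rw [← pow_add, Nat.div_add_mod]
  have hcomm : (BS.y : BS m n) ^ (n * u) * BS.y ^ a k = BS.y ^ a k * BS.y ^ (n * u) := by
    rw [← pow_add, ← pow_add, add_comm]
  calc tower a (k + 1) * BS.y ^ (n * (m * u / n))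
      = tower a k * (BS.y ^ a k * (BS.x * BS.y ^ (m * u))) * (BS.y ^ (m * u % n))⁻¹ := by
        rw [tower_succ, hsplit]
        group
    _ = tower a k * (BS.y ^ (n * u) * BS.y ^ a k * BS.x) * (BS.y ^ (m * u % n))⁻¹ := by
        rw [← hrel, hcomm]
        group
    _ = _ := by group

lemma eq_of_div_eq_of_modEq {d m n u v : ℕ} (hd : 0 < d) (hm : 0 < m) (hn : 0 < n)
    (h : d * m * u / (d * n) = d * m * v / (d * n)) (h' : u ≡ v [MOD n]) : u = v := by
  wlog huv : u ≤ v generalizing u v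
  · exact (this h.symm h'.symm (by omega)).symm
  obtain ⟨c, hc⟩ := (Nat.modEq_iff_dvd' huv).1 h'
  obtain rfl : v = u + n * c := by omega
  rw [show d * m * (u + n * c) = d * m * u + d * n * (m * c) by ring,
    Nat.add_mul_div_left _ _ (by positivity)] at h
  have : m * c = 0 := by omega
  rcases Nat.mul_eq_zero.1 this with h | rfl
  · omega
  · simp

/-- The extension of a finite sequence of digits by zero. -/
def digits {h n : ℕ} (a : Fin h → Fin n) (j : ℕ) : ℕ :=
  if hj : j < h then a ⟨j, hj⟩ else 0

lemma digits_lt {h n : ℕ} (hn : 0 < n) (a : Fin h → Fin n) (j : ℕ) : digits a j < n := by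
  unfold digits
  split_ifs
  · exact Fin.is_lt _
  · exact hn

open scoped Classical in
/-- Few of the climbing paths pass through a given vertex at a given time. -/
lemma card_climb_eq_le {d m n : ℕ} (hd : 0 < d) (hm : 0 < m) (hn : 0 < n) (hmn : m.Coprime n)
    (L h k : ℕ) (hk : k ≤ h) (z : BS (d * m : ℕ) (d * n : ℕ)) :
    ((Finset.range L ×ˢ (Finset.univ : Finset (Fin h → Fin n))).filter
      fun p => climb p.1 (digits p.2) k = z).card ≤ n ^ h := by
  let lev : ℕ → ℕ → ℕ := fun q s => (fun u => d * m * u / (d * n))^[s] q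
  calc _ ≤ (Finset.univ : Finset (Fin h → Fin n)).card := by
        refine Finset.card_le_card_of_injOn (fun p s =>
          if (s : ℕ) < k then ⟨lev p.1 s % n, Nat.mod_lt _ hn⟩ else p.2 s) (by simp) ?_
        rintro ⟨q, a⟩ hp ⟨q', a'⟩ hp' heq
        simp only [Finset.mem_coe, Finset.mem_filter] at hp hp'
        have h1 := hp.2.trans hp'.2.symm
        obtain ⟨hdig, hlev⟩ := tower_mul_pow_injective hd hm hn hmn _ _ (digits_lt hn a)
          (digits_lt hn a') k _ _ h1
        have hlev' : lev q k = lev q' k := Nat.eq_of_mul_eq_mul_left (by positivity) hlev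
        have hmod : ∀ s < k, lev q s ≡ lev q' s [MOD n] := by
          intro s hs
          have := congrFun heq ⟨s, by omega⟩
          simp only [hs, if_true, Fin.mk.injEq] at this
          exact this
        have hdown : ∀ j ≤ k, lev q (k - j) = lev q' (k - j) := by
          intro j
          induction j with
          | zero => intro _; exact hlev'
          | succ j ih =>
            intro hj
            refine eq_of_div_eq_of_modEq hd hm hn ?_ (hmod _ (by omega))
            have := ih (by omega)
            rw [show k - j = (k - (j + 1)) + 1 by omega] at this
            simpa only [lev, Function.iterate_succ_apply'] using this
        have hq : q = q' := by simpa [lev] using hdown k le_rfl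
        refine Prod.ext hq (funext fun s => ?_)
        by_cases hs : (s : ℕ) < k
        · have := hdig s hs
          simp only [digits, s.is_lt, dif_pos] at this
          exact Fin.ext this
        · have := congrFun heq s
          simpa only [hs, if_false] using this
    _ = n ^ h := by simp

lemma iterate_mul_div_eq_zero {m n h q : ℕ} (hq : m ^ h * q < n ^ h) :
    (fun u => m * u / n)^[h] q = 0 := by
  have key : ∀ k, n ^ k * (fun u => m * u / n)^[k] q ≤ m ^ k * q := by
    intro k
    induction k with
    | zero => simp
    | succ k ih =>
      rw [Function.iterate_succ_apply']
      calc n ^ (k + 1) * (m * (fun u => m * u / n)^[k] q / n)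
          = n ^ k * (n * (m * (fun u => m * u / n)^[k] q / n)) := by ring
        _ ≤ n ^ k * (m * (fun u => m * u / n)^[k] q) := Nat.mul_le_mul_left _ (Nat.mul_div_le _ _)
        _ = m * (n ^ k * (fun u => m * u / n)^[k] q) := by ring
        _ ≤ m * (m ^ k * q) := by gcongr
        _ = m ^ (k + 1) * q := by ring
  by_contra hne
  have h1 := (key h).trans_lt hq
  have h2 := Nat.le_mul_of_pos_right (n ^ h) (Nat.pos_of_ne_zero hne)
  omega

end BS

end Tower

section FreeByCyclic

/-- A coarse map to the product of a free group and `ℤ`, seen through its two coordinates. -/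
lemma CoarseMap.exists_coordinates {G α : Type*} [Group G] [DecidableEq α]
    {f : G → FreeGroup α × Multiplicative ℤ} (hf : CoarseMap f) {E : Set G} (hE : E.Finite) :
    ∃ (φ : G → FreeGroup α) (ζ : G → ℤ) (N : Finset (FreeGroup α)) (M B : ℕ), 1 ∈ N ∧
      (∀ g, ∀ e ∈ E, |ζ (g * e) - ζ g| ≤ M) ∧
      (∀ g, ∀ e ∈ E, ∀ w, ¬ (w <:+ (φ (g * e)).toWord ↔ w <:+ (φ g).toWord) →
        ∃ ν ∈ N, (ν * φ g).toWord = w) ∧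
      ∀ (w : List (α × Bool)) (z : ℤ) (r : ℕ) (S : Finset G),
        (∀ g ∈ S, (∃ ν ∈ N, (ν * φ g).toWord = w) ∧ |ζ g - z| ≤ r) →
          S.card ≤ B * (2 * r + 1) := by
  classical
  obtain ⟨D, hD, hlip⟩ := hf.lipschitz E hE
  lift D to Finset (FreeGroup α × Multiplicative ℤ) using hD
  obtain ⟨B, hB⟩ := hf.exists_card_le
  choose P hP using FreeGroup.exists_finite_suffix_crossing (α := α)
  let N := insert 1 (D.biUnion fun x => P x.1⁻¹)
  refine ⟨fun g => (f g).1⁻¹, fun g => (f g).2.toAdd, N, ∑ x ∈ D, x.2.toAdd.natAbs,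
    B * N.card, Finset.mem_insert_self _ _, ?_, ?_, ?_⟩
  · intro g e he
    have h1 := Finset.single_le_sum (f := fun x => x.2.toAdd.natAbs) (fun _ _ => Nat.zero_le _)
      (hlip g e he)
    have h2 : (f (g * e)).2.toAdd - (f g).2.toAdd = ((f g)⁻¹ * f (g * e)).2.toAdd := by
      simp
      ring
    rw [h2, Int.abs_eq_natAbs]
    exact_mod_cast h1
  · intro g e he w hw
    have h2 : (f (g * e)).1⁻¹ = (((f g)⁻¹ * f (g * e)).1)⁻¹ * (f g).1⁻¹ := by simp
    dsimp only at hw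
    rw [h2] at hw
    obtain ⟨ν, hν, h⟩ := hP _ w _ hw
    exact ⟨ν, Finset.mem_insert_of_mem (Finset.mem_biUnion.2 ⟨_, hlip g e he, hν⟩), h⟩
  · intro w z r S hS
    have himage : S.image f ⊆ (N ×ˢ Finset.Icc (z - r) (z + r)).image
        fun p => ((FreeGroup.mk w)⁻¹ * p.1, Multiplicative.ofAdd p.2) := by
      intro y hy
      obtain ⟨g, hg, rfl⟩ := Finset.mem_image.1 hy
      obtain ⟨⟨ν, hν, hw⟩, hz⟩ := hS g hg
      rw [abs_le] at hz
      refine Finset.mem_image.2 ⟨(ν, (f g).2.toAdd), Finset.mem_product.2 ⟨hν, ?_⟩, ?_⟩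
      · exact Finset.mem_Icc.2 ⟨by linarith, by linarith⟩
      · refine Prod.ext ?_ rfl
        simp only [← hw, FreeGroup.mk_toWord]
        group
    calc S.card ≤ B * (S.image f).card := by convert hB S
      _ ≤ B * (N.card * (2 * r + 1)) := by
        gcongr
        refine (Finset.card_le_card himage).trans (Finset.card_image_le.trans ?_)
        rw [Finset.card_product, Int.card_Icc]
        gcongr
        omega
      _ = B * N.card * (2 * r + 1) := by ring

namespace BS

open scoped Classical in
theorem not_quasiIsometric_freeGroup_prod {d m n : ℕ} (hd : 0 < d) (hm : 0 < m) (hmn : m < n)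
    (hcop : m.Coprime n) (α : Type*) [Fintype α] :
    ¬ QuasiIsometricGroups (BS (d * m : ℕ) (d * n : ℕ)) (FreeGroup α × Multiplicative ℤ) := by
  intro hqi
  have hn : 0 < n := hm.trans hmn
  obtain ⟨f, hf⟩ := hqi.exists_coarseMap
  let E : Set (BS (d * m : ℕ) (d * n : ℕ)) :=
    Set.image2 (fun a r => BS.y ^ a * BS.x * (BS.y ^ r)⁻¹) (Set.Iio n) (Set.Iio (d * n))
  have hE : E.Finite := (Set.finite_Iio n).image2 _ (Set.finite_Iio (d * n))
  obtain ⟨φ, ζ, N, M, B, hN, hζ, hcross, hcard⟩ := hf.exists_coordinates hE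
  have hstep : ∀ (q : ℕ) (a : ℕ → ℕ) (k : ℕ), (∀ j, a j < n) → ∃ e ∈ E,
      (climb q a (k + 1) : BS (d * m : ℕ) (d * n : ℕ)) = climb q a k * e :=
    fun q a k ha => ⟨_, ⟨_, ha k, _, Nat.mod_lt _ (by positivity), rfl⟩, climb_succ q a k⟩
  let p := Fintype.card (α × Bool)
  let b := B * (6 * M + 1)
  obtain ⟨h, hh⟩ := exists_pow_mul_lt_pow (Nat.mul_lt_mul_of_pos_left hmn hd)
    (4 * (p + 1) * b + 1)
  set L := (4 * (p + 1) * b + 1) * (h + 1) ^ 2 with hL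
  have hend : ∀ q < L, ∀ a : ℕ → ℕ,
      (climb q a h : BS (d * m : ℕ) (d * n : ℕ)) = tower a h := by
    intro q hq a
    rw [climb, iterate_mul_div_eq_zero ((Nat.mul_le_mul_left _ hq.le).trans_lt hh)]
    simp
  have hstart : ∀ (q : ℕ) (a : ℕ → ℕ),
      (climb q a 0 : BS (d * m : ℕ) (d * n : ℕ)) = BS.y ^ (d * n * q) := by
    intro q a
    simp [climb, tower]
  have hζpath : ∀ (q : ℕ) (a : ℕ → ℕ) (k : ℕ), (∀ j, a j < n) →
      |ζ (climb q a k) - ζ (climb q a 0)| ≤ k * M := by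
    intro q a k ha
    induction k with
    | zero => simp
    | succ k ih =>
      obtain ⟨e, he, heq⟩ := hstep q a k ha
      rw [heq]
      refine (abs_sub_le _ (ζ (climb q a k)) _).trans ?_
      push_cast
      linarith [hζ (climb q a k) e he]
  have hζbound : ∀ q < L, ∀ a : ℕ → ℕ, (∀ j, a j < n) → ∀ k ≤ h,
      |ζ (climb q a k) - ζ 1| ≤ (3 * h * M : ℕ) := by
    intro q hq a ha k hk
    have h1 := abs_le.1 (hζpath q a k ha)
    have h2 := abs_le.1 (hζpath q a h ha)
    have h3 := abs_le.1 (hζpath 0 a h ha)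
    rw [hend q hq] at h2
    rw [hend 0 (by positivity), hstart, mul_zero, pow_zero] at h3
    have h4 : (k : ℤ) * M ≤ h * M := by gcongr
    push_cast
    rw [abs_le]
    constructor <;> linarith
  let near : List (α × Bool) → BS (d * m : ℕ) (d * n : ℕ) → Prop :=
    fun w g => (∃ ν ∈ N, (ν * φ g).toWord = w) ∧ |ζ g - ζ 1| ≤ (3 * h * M : ℕ)
  let X := B * (2 * (3 * h * M) + 1)
  have hnear : ∀ w (S : Finset (BS (d * m : ℕ) (d * n : ℕ))), (∀ g ∈ S, near w g) → S.card ≤ X :=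
    fun w S hS => hcard w _ _ S hS
  have hX : X ≤ b * (h + 1) := by
    calc X = B * (6 * M * h + 1) := by simp only [X]; ring
      _ ≤ B * ((6 * M + 1) * (h + 1)) := by gcongr; nlinarith
      _ = b * (h + 1) := by simp only [b]; ring
  let u : ℕ → List (α × Bool) := fun q => (φ (BS.y ^ (d * n * q))).toWord
  have hu : ∀ w, ((Finset.range L).filter fun q => u q = w).card ≤ X := by
    intro w
    have hinj : Function.Injective fun q => (BS.y : BS (d * m : ℕ) (d * n : ℕ)) ^ (d * n * q) := by
      intro q q' hq
      refine Nat.eq_of_mul_eq_mul_left (Nat.mul_pos hd hn) (tower_mul_pow_injective hd hm hn hcop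
        0 0 (fun _ => hn) (fun _ => hn) 0 _ _ ?_).2
      simpa [tower] using hq
    rw [← Finset.card_image_of_injective _ hinj]
    refine hnear w _ fun g hg => ?_
    obtain ⟨q, hq, rfl⟩ := Finset.mem_image.1 hg
    rw [Finset.mem_filter, Finset.mem_range] at hq
    refine ⟨⟨1, hN, by simpa [u] using hq.2⟩, ?_⟩
    have := hζbound q hq.1 0 (fun _ => hn) 0 (Nat.zero_le _)
    rwa [hstart] at this
  obtain ⟨w, hw1, hw2⟩ := exists_balanced_suffix u L X (by positivity) hu (by
    calc 4 * X ≤ 4 * (b * (h + 1)) := by gcongr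
      _ = 4 * 1 * b * (h + 1) ^ 1 := by ring
      _ ≤ 4 * (p + 1) * b * (h + 1) ^ 2 := by gcongr <;> omega
      _ ≤ L := by rw [hL]; gcongr; omega)
  set U := (Finset.range L).filter fun q => w <:+ u q
  let bad := (Finset.range L ×ˢ (Finset.univ : Finset (Fin h → Fin n))).filter fun x =>
    ∃ k ≤ h, near w (climb x.1 (digits x.2) k)
  have hbad_le : bad.card ≤ (h + 1) * X * n ^ h := by
    let at_time : ℕ → Finset (BS (d * m : ℕ) (d * n : ℕ)) := fun k =>
      ((Finset.range L ×ˢ (Finset.univ : Finset (Fin h → Fin n))).image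
        fun x => climb x.1 (digits x.2) k).filter (near w)
    have hsub : bad ⊆ (Finset.range (h + 1)).biUnion fun k => (at_time k).biUnion fun z =>
        (Finset.range L ×ˢ (Finset.univ : Finset (Fin h → Fin n))).filter
          fun x => climb x.1 (digits x.2) k = z := by
      intro x hx
      obtain ⟨hx, k, hk, hxk⟩ := Finset.mem_filter.1 hx
      refine Finset.mem_biUnion.2 ⟨k, Finset.mem_range.2 (by omega), Finset.mem_biUnion.2
        ⟨_, Finset.mem_filter.2 ⟨Finset.mem_image_of_mem _ hx, hxk⟩,
          Finset.mem_filter.2 ⟨hx, rfl⟩⟩⟩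
    calc bad.card ≤ (Finset.range (h + 1)).card * (X * n ^ h) := by
          refine (Finset.card_le_card hsub).trans (Finset.card_biUnion_le_card_mul _ _ _ ?_)
          intro k hk
          refine (Finset.card_biUnion_le_card_mul _ _ (n ^ h) fun z _ => ?_).trans ?_
          · exact card_climb_eq_le hd hm hn hcop L h k (by simpa [Nat.lt_succ_iff] using hk) z
          · gcongr
            exact hnear w _ fun g hg => (Finset.mem_filter.1 hg).2
      _ = (h + 1) * X * n ^ h := by rw [Finset.card_range]; ring
  have hside : ∀ q < L, ∀ a : Fin h → Fin n, (q, a) ∉ bad →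
      (q ∈ U ↔ w <:+ (φ (tower (digits a) h)).toWord) := by
    intro q hq a ha
    have hgood : ∀ k ≤ h, ¬ near w (climb q (digits a) k) := by
      intro k hk hk'
      exact ha (Finset.mem_filter.2 ⟨by simpa using hq, k, hk, hk'⟩)
    have hpath : ∀ k ≤ h, (w <:+ (φ (climb q (digits a) k)).toWord ↔
        w <:+ (φ (climb q (digits a) 0)).toWord) := by
      intro k hk
      induction k with
      | zero => rfl
      | succ k ih =>
        obtain ⟨e, he, heq⟩ := hstep q (digits a) k (digits_lt hn a)
        rw [← ih (by omega), heq]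
        by_contra hne
        exact hgood k (by omega) ⟨hcross _ _ he _ hne,
          hζbound q hq _ (digits_lt hn a) k (by omega)⟩
    rw [← hend q hq, hpath h le_rfl, hstart]
    simp [U, u, hq]
  have hle_bad : U.card * n ^ h ≤ bad.card := by
    have hUL : U ⊆ Finset.range L := Finset.filter_subset _ _
    have hfiber : ∀ a : Fin h → Fin n, U.card ≤ (bad.filter fun x => x.2 = a).card := by
      intro a
      have hsub : ∀ V : Finset ℕ, (∀ q ∈ V, (q, a) ∈ bad) →
          V.card ≤ (bad.filter fun x => x.2 = a).card := fun V hV =>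
        Finset.card_le_card_of_injOn (fun q => (q, a)) (fun q hq => by simpa using hV q hq)
          fun _ _ _ _ h => congrArg Prod.fst h
      by_cases htop : w <:+ (φ (tower (digits a) h)).toWord
      · have hcompl : U.card ≤ (Finset.range L \ U).card := by
          rw [Finset.card_sdiff_of_subset hUL, Finset.card_range]
          omega
        refine hcompl.trans (hsub _ fun q hq => ?_)
        by_contra hq'
        rw [Finset.mem_sdiff, Finset.mem_range] at hq
        exact hq.2 ((hside q hq.1 a hq').2 htop)
      · refine hsub U fun q hq => ?_
        by_contra hq'
        exact htop ((hside q (Finset.mem_range.1 (hUL hq)) a hq').1 hq)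
    calc U.card * n ^ h = ∑ _a : Fin h → Fin n, U.card := by simp [mul_comm]
      _ ≤ ∑ a : Fin h → Fin n, (bad.filter fun x => x.2 = a).card :=
        Finset.sum_le_sum fun a _ => hfiber a
      _ = bad.card := (Finset.card_eq_sum_card_fiberwise fun _ _ => Finset.mem_univ _).symm
  have hfin : U.card ≤ (h + 1) * X :=
    Nat.le_of_mul_le_mul_right (hle_bad.trans hbad_le) (by positivity)
  have : L ≤ 4 * (p + 1) * b * (h + 1) ^ 2 := by
    calc L ≤ 4 * (p + 1) * U.card := hw1
      _ ≤ 4 * (p + 1) * ((h + 1) * (b * (h + 1))) := by gcongr; exact hfin.trans (by gcongr)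
      _ = _ := by ring
  have h1 : 0 < (h + 1) ^ 2 := by positivity
  rw [hL, add_mul] at this
  omega

end BS

end FreeByCyclic

/-- For `1 < m < n`, the group `BS(m,n)` is quasi-isometric neither to `F_k × ℤ` for
any `k ≥ 1` nor to any solvable Baumslag–Solitar group `BS(1,q)`, `q > 1`. -/
theorem higher_BS_not_qi_degenerate (m n : ℤ) (hm : 1 < m) (hmn : m < n) :
    (∀ k : ℕ, 1 ≤ k →
      ¬ QuasiIsometricGroups (BS m n) (FreeGroup (Fin k) × Multiplicative ℤ)) ∧
    (∀ q : ℤ, 1 < q → ¬ QuasiIsometricGroups (BS m n) (BS 1 q)) := by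
  refine ⟨fun k _ => ?_, fun q hq => BS.not_quasiIsometric_solvable hm (hm.trans hmn) hq⟩
  lift m to ℕ using by omega
  lift n to ℕ using by omega
  have hm0 : 0 < m := by omega
  obtain ⟨m', n', hcop, hm', hn'⟩ := Nat.exists_coprime m n
  have hd : 0 < m.gcd n := Nat.gcd_pos_of_pos_left n hm0
  generalize m.gcd n = d at *
  subst hm' hn'
  rw [mul_comm m', mul_comm n']
  rw [mul_comm m', mul_comm n'] at hmn
  rw [mul_comm] at hm0
  exact BS.not_quasiIsometric_freeGroup_prod hd (Nat.pos_of_mul_pos_left hm0)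
    (Nat.lt_of_mul_lt_mul_left (by exact_mod_cast hmn)) hcop _
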